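/- There exists exactly one triple (α,β,γ) ∈ ℂ³ minimizing Φ over ℂ³, and this minimizer satisfies: α, β, γ are real and β = γ. (The degree-one optimal polynomial approximant p₁ to 1/f exists, is unique, has real coefficients, and has the symmetric form p₁(z₁,z₂) = a + b(z₁+z₂).) -/

import Mathlib

open Finset

/-- Maclaurin coefficients of `F(z) = (1 - √(2/3) z)^(-5/2)`. -/
noncomputable def a : ℕ → ℝ :=
  fun j => ∏ t ∈ Finset.Icc 1 j, (Real.sqrt (2 / 3) * (1 + 3 / (2 * (t : ℝ))))

/-- Taylor coefficients of `f(z₁,z₂) = (1 - (z₁+z₂)/√6)^(-5/2)` at `z₁^k z₂^l`. -/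
noncomputable def c : ℕ → ℕ → ℝ :=
  fun k l => a (k + l) * (Nat.choose (k + l) k : ℝ) / 2 ^ (k + l)

/-- Squared `H²(𝔻²)`-norm of `1 - (α + β z₁ + γ z₂) f`. -/
noncomputable def Φ : ℂ → ℂ → ℂ → ℝ :=
  fun α β γ =>
    ∑' p : ℕ × ℕ,
      ‖(if p = (0, 0) then (1 : ℂ) else 0)
        - α * (c p.1 p.2 : ℂ)
        - β * (if p.1 = 0 then (0 : ℂ) else (c (p.1 - 1) p.2 : ℂ))
        - γ * (if p.2 = 0 then (0 : ℂ) else (c p.1 (p.2 - 1) : ℂ))‖ ^ 2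

lemma a_succ (n : ℕ) : a (n+1) = a n * (Real.sqrt (2 / 3) * (1 + 3 / (2 * ((n+1 : ℕ) : ℝ)))) := by
  unfold a
  rw [Finset.prod_Icc_succ_top (by omega)]

lemma a_pos (n : ℕ) : 0 < a n := by
  unfold a
  apply Finset.prod_pos
  intro t ht
  positivity

lemma a_summable : Summable a := by
  have hlt : Real.sqrt (2/3) < 1 := by
    rw [Real.sqrt_lt' one_pos]; norm_num
  refine summable_of_ratio_test_tendsto_lt_one (l := Real.sqrt (2/3)) hlt
    (Filter.Eventually.of_forall fun n => (a_pos n).ne') ?_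
  have h1 : Filter.Tendsto (fun n : ℕ => (3/2 : ℝ) * (1 / ((n : ℝ) + 1))) Filter.atTop (nhds ((3/2) * 0)) :=
    tendsto_one_div_add_atTop_nhds_zero_nat.const_mul _
  have h2 := (h1.const_add 1).const_mul (Real.sqrt (2/3))
  simp only [mul_zero, add_zero, mul_one] at h2
  refine h2.congr fun n => ?_
  rw [Real.norm_of_nonneg (a_pos _).le, Real.norm_of_nonneg (a_pos _).le, a_succ,
    mul_div_cancel_left₀ _ (a_pos n).ne']
  push_cast
  congr 2
  have : (n : ℝ) + 1 ≠ 0 := by positivity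
  field_simp

lemma c_nonneg (k l : ℕ) : 0 ≤ c k l := by
  unfold c
  have := (a_pos (k+l)).le
  positivity

lemma c_summable : Summable (fun p : ℕ × ℕ => c p.1 p.2) := by
  rw [← Finset.HasAntidiagonal.sigmaAntidiagonalEquivProd.summable_iff]
  refine (summable_sigma_of_nonneg (fun x => by simpa using c_nonneg _ _)).mpr ⟨fun n => Summable.of_finite, ?_⟩
  refine a_summable.congr fun n => ?_
  rw [tsum_fintype]
  have h : ∀ b : ((Finset.HasAntidiagonal.antidiagonal n : Finset (ℕ × ℕ)) : Type),
      ((fun p : ℕ × ℕ => c p.1 p.2) ∘ Finset.HasAntidiagonal.sigmaAntidiagonalEquivProd) ⟨n, b⟩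
      = (fun p : ℕ × ℕ => a n * (n.choose p.1 : ℝ) / 2 ^ n) b.1 := by
    rintro ⟨⟨k, l⟩, hb⟩
    have : k + l = n := by simpa using hb
    subst this
    simp [c]
  rw [Finset.sum_congr rfl (fun b _ => h b)]
  rw [Finset.sum_coe_sort (Finset.HasAntidiagonal.antidiagonal n) (fun p : ℕ × ℕ => a n * (n.choose p.1 : ℝ) / 2 ^ n)]
  rw [Finset.Nat.sum_antidiagonal_eq_sum_range_succ_mk]
  simp only
  rw [← Finset.sum_div, ← Finset.mul_sum]
  have h2 : (∑ k ∈ Finset.range n.succ, (n.choose k : ℝ)) = 2 ^ n := by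
    exact_mod_cast Nat.sum_range_choose n
  rw [h2]
  field_simp

lemma c_sq_summable : Summable (fun p : ℕ × ℕ => (c p.1 p.2)^2) := by
  refine Summable.of_nonneg_of_le (fun p => sq_nonneg _) (fun p => ?_)
    (c_summable.mul_left (∑' p : ℕ × ℕ, c p.1 p.2))
  have h1 : c p.1 p.2 ≤ ∑' p : ℕ × ℕ, c p.1 p.2 :=
    c_summable.le_tsum p (fun q _ => c_nonneg q.1 q.2)
  rw [sq]
  exact mul_le_mul_of_nonneg_right h1 (c_nonneg _ _)

noncomputable def vA : ℕ × ℕ → ℂ := fun p => (c p.1 p.2 : ℂ)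
noncomputable def vB : ℕ × ℕ → ℂ := fun p => (if p.1 = 0 then (0 : ℂ) else (c (p.1 - 1) p.2 : ℂ))
noncomputable def vC : ℕ × ℕ → ℂ := fun p => (if p.2 = 0 then (0 : ℂ) else (c p.1 (p.2 - 1) : ℂ))
noncomputable def vE : ℕ × ℕ → ℂ := fun p => (if p = (0, 0) then (1 : ℂ) else 0)

lemma mem_of_sq {f : ℕ × ℕ → ℂ} (h : Summable fun p => ‖f p‖ ^ 2) : Memℓp f 2 := by
  apply memℓp_gen
  simpa using h

lemma memA : Memℓp vA 2 := mem_of_sq (c_sq_summable.congr fun p => by simp [vA])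

lemma memB : Memℓp vB 2 := by
  apply mem_of_sq
  have hi : Function.Injective (fun p : ℕ × ℕ => (p.1 + 1, p.2)) := by
    rintro ⟨x, y⟩ ⟨z, w⟩ h; simpa using h
  rw [← hi.summable_iff]
  · exact c_sq_summable.congr fun p => by simp [vB]
  · rintro ⟨x, y⟩ h
    rcases x with _ | x
    · simp [vB]
    · exact absurd ⟨(x, y), rfl⟩ h

lemma memC : Memℓp vC 2 := by
  apply mem_of_sq
  have hi : Function.Injective (fun p : ℕ × ℕ => (p.1, p.2 + 1)) := by
    rintro ⟨x, y⟩ ⟨z, w⟩ h; simpa using h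
  rw [← hi.summable_iff]
  · exact c_sq_summable.congr fun p => by simp [vC]
  · rintro ⟨x, y⟩ h
    rcases y with _ | y
    · simp [vC]
    · exact absurd ⟨(x, y), rfl⟩ h

lemma memE : Memℓp vE 2 := by
  apply mem_of_sq
  apply summable_of_ne_finset_zero (s := {(0,0)})
  intro p hp
  simp at hp
  simp [vE, hp]

noncomputable abbrev HH := lp (fun _ : ℕ × ℕ => ℂ) 2
noncomputable def wA : HH := ⟨vA, memA⟩
noncomputable def wB : HH := ⟨vB, memB⟩
noncomputable def wC : HH := ⟨vC, memC⟩
noncomputable def wE : HH := ⟨vE, memE⟩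

noncomputable def LL : (ℂ × ℂ × ℂ) →ₗ[ℂ] HH where
  toFun p := p.1 • wA + p.2.1 • wB + p.2.2 • wC
  map_add' p q := by simp only [Prod.fst_add, Prod.snd_add, add_smul]; abel
  map_smul' r p := by simp [mul_smul]

lemma LL_coe (p : ℂ × ℂ × ℂ) (i : ℕ × ℕ) :
    (LL p : ℕ × ℕ → ℂ) i = p.1 * vA i + p.2.1 * vB i + p.2.2 * vC i := rfl

lemma Phi_eq (p : ℂ × ℂ × ℂ) : Φ p.1 p.2.1 p.2.2 = ‖wE - LL p‖ ^ 2 := by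
  have h := lp.norm_rpow_eq_tsum (p := 2) (by norm_num) (wE - LL p)
  simp only [ENNReal.toReal_ofNat, Real.rpow_ofNat] at h
  rw [h]
  unfold Φ
  refine tsum_congr fun i => ?_
  have : ((wE - LL p : HH) : ℕ × ℕ → ℂ) i
    = vE i - (p.1 * vA i + p.2.1 * vB i + p.2.2 * vC i) := rfl
  rw [this]
  congr 2
  simp only [vE, vA, vB, vC]
  ring

lemma LL_inj : Function.Injective LL := by
  rw [← LinearMap.ker_eq_bot, LinearMap.ker_eq_bot']
  rintro ⟨x, y, z⟩ h
  have h' : ∀ i, x * vA i + y * vB i + z * vC i = 0 := fun i => by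
    have := LL_coe (x, y, z) i
    rw [h] at this
    exact this.symm
  have h0 := h' (0,0)
  have h1 := h' (1,0)
  have h2 := h' (0,1)
  have ha : c 0 0 = 1 := by simp [c, a]
  simp [vA, vB, vC, ha] at h0
  subst h0
  simp [vA, vB, vC, ha] at h1 h2
  simp [h1, h2]

lemma exu : ∃! p : ℂ × ℂ × ℂ, ∀ q : ℂ × ℂ × ℂ, Φ p.1 p.2.1 p.2.2 ≤ Φ q.1 q.2.1 q.2.2 := by
  let K := LinearMap.range LL
  obtain ⟨p, hp⟩ : (K.starProjection wE) ∈ K := Submodule.starProjection_apply_mem _ _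
  have key : ∀ q, Φ q.1 q.2.1 q.2.2 = Φ p.1 p.2.1 p.2.2 + ‖LL p - LL q‖ ^ 2 := by
    intro q
    rw [Phi_eq, Phi_eq]
    have ho : inner ℂ (wE - LL p) (LL p - LL q) = 0 := by
      rw [hp]
      exact K.starProjection_inner_eq_zero wE _ (K.sub_mem (hp ▸ ⟨p, rfl⟩) ⟨q, rfl⟩)
    have := norm_add_sq_eq_norm_sq_add_norm_sq_of_inner_eq_zero _ _ ho
    rw [sub_add_sub_cancel] at this
    simpa [sq] using this
  refine ⟨p, fun q => ?_, fun q hq => ?_⟩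
  · rw [key q]; have := sq_nonneg ‖LL p - LL q‖; linarith
  · have h1 := hq p
    rw [key q] at h1
    have h2 : ‖LL p - LL q‖ ^ 2 = 0 := le_antisymm (by linarith) (sq_nonneg _)
    have h3 : LL p - LL q = 0 := by simpa using h2
    exact (LL_inj (sub_eq_zero.mp h3)).symm

lemma c_symm (k l : ℕ) : c k l = c l k := by
  unfold c
  rw [add_comm l k, Nat.choose_symm_add]

lemma Phi_swap (x y z : ℂ) : Φ x y z = Φ x z y := by
  unfold Φ
  rw [← (Equiv.prodComm ℕ ℕ).tsum_eq]
  refine tsum_congr fun i => ?_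
  obtain ⟨k, l⟩ := i
  simp only [Equiv.prodComm_apply, Prod.swap, Prod.mk.injEq]
  rw [c_symm l k, c_symm (l-1) k, c_symm l (k-1)]
  congr 2
  by_cases hk : k = 0 <;> by_cases hl : l = 0 <;> simp [hk, hl] <;> ring

lemma Phi_conj (x y z : ℂ) : Φ (star x) (star y) (star z) = Φ x y z := by
  unfold Φ
  refine tsum_congr fun i => ?_
  rw [← norm_star]
  congr 2
  simp only [star_sub, star_mul', Complex.star_def, Complex.conj_conj, Complex.conj_ofReal, apply_ite (starRingEnd ℂ), map_zero, map_one]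

/-- The minimizer of `Φ` is unique, real, and symmetric (`β = γ`). -/
theorem opa_unique_real_symmetric :
    (∃! p : ℂ × ℂ × ℂ, ∀ q : ℂ × ℂ × ℂ, Φ p.1 p.2.1 p.2.2 ≤ Φ q.1 q.2.1 q.2.2) ∧
    (∀ α β γ : ℂ, (∀ α' β' γ' : ℂ, Φ α β γ ≤ Φ α' β' γ') →
      α.im = 0 ∧ β.im = 0 ∧ γ.im = 0 ∧ β = γ) := by
  refine ⟨exu, fun α β γ h => ?_⟩
  have h0 := exu.unique (y₁ := (α, β, γ)) (y₂ := (α, γ, β)) (fun q => h _ _ _)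
    (fun q => by simpa only [Phi_swap α γ β] using h _ _ _)
  have h1 := exu.unique (y₁ := (star α, star β, star γ)) (y₂ := (α, β, γ))
    (fun q => by simpa only [Phi_conj] using h _ _ _) (fun q => h _ _ _)
  simp only [Prod.mk.injEq] at h0 h1
  exact ⟨Complex.conj_eq_iff_im.mp h1.1, Complex.conj_eq_iff_im.mp h1.2.1,
    Complex.conj_eq_iff_im.mp h1.2.2, h0.2.1⟩
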